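/- arXiv:1007.0551 — 4 statements merged into one kernel-verified Lean document; each statement's English description precedes it below -/
import Mathlib

section
/- Let E₀, F₀, F₁, F₂ be complex Hilbert spaces, let P : F₀ → E₀ be a bounded linear operator, and let T : F₀ → F₁ and S : F₁ → F₂ be closed, densely defined (in general unbounded) linear operators such that for every x in the domain of T, the element Tx lies in the domain of S and S(Tx) = 0. Let G ⊆ E₀ be a closed subspace such that P(Ker T) ⊆ G. Then P(Ker T) = G if and only if there exists a constant C > 0 such that ‖P*u + T*β‖² + ‖Sβ‖² ≥ C‖u‖² for every u ∈ G and every β lying in Dom T* ∩ Dom S, where P* : E₀ → F₀ is the (bounded) Hilbert-space adjoint of P and T* : F₁ → F₀ is the adjoint of the densely defined operator T. -/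
namespace LinearPMap

variable {𝕜 E F : Type*} [RCLike 𝕜] [NormedAddCommGroup E] [InnerProductSpace 𝕜 E]
  [NormedAddCommGroup F] [InnerProductSpace 𝕜 F]

/-- The kernel of a partially defined linear map, as a submodule of the ambient space. -/
def kernel (T : E →ₗ.[𝕜] F) : Submodule 𝕜 E :=
  T.graph.comap (LinearMap.inl 𝕜 E F)

theorem mem_kernel_iff_mem_graph {T : E →ₗ.[𝕜] F} {x : E} : x ∈ T.kernel ↔ (x, 0) ∈ T.graph :=
  Iff.rfl

theorem mem_kernel_iff {T : E →ₗ.[𝕜] F} {x : E} :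
    x ∈ T.kernel ↔ ∃ hx : x ∈ T.domain, T ⟨x, hx⟩ = 0 := by
  simp [mem_kernel_iff_mem_graph, mem_graph_iff]

theorem IsClosed.isClosed_kernel {T : E →ₗ.[𝕜] F} (hT : T.IsClosed) :
    _root_.IsClosed (T.kernel : Set E) :=
  _root_.IsClosed.preimage (f := fun x : E => (x, (0 : F))) (by fun_prop) hT

variable [CompleteSpace E]

theorem mem_graph_adjoint_iff {T : E →ₗ.[𝕜] F} (hT : Dense (T.domain : Set E)) {y : F} {v : E} :
    (y, v) ∈ T.adjoint.graph ↔ ∀ x : T.domain, inner 𝕜 v (x : E) = inner 𝕜 y (T x) := by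
  rw [mem_graph_iff]
  constructor
  · rintro ⟨y, rfl, rfl⟩ x
    exact adjoint_isFormalAdjoint hT y x
  · intro h
    exact ⟨⟨y, mem_adjoint_domain_of_exists y ⟨v, h⟩⟩, rfl, adjoint_apply_eq hT _ h⟩

/-- Projecting onto a subspace containing the range of `T` does not change the value of `T†`. -/
theorem starProjection_mem_graph_adjoint {T : E →ₗ.[𝕜] F} (hT : Dense (T.domain : Set E))
    {V : Submodule 𝕜 F} [V.HasOrthogonalProjection] (hV : ∀ x : T.domain, T x ∈ V) {y : F} {v : E}
    (h : (y, v) ∈ T.adjoint.graph) : (V.starProjection y, v) ∈ T.adjoint.graph := by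
  rw [mem_graph_adjoint_iff hT] at h ⊢
  intro x
  have := V.starProjection_inner_eq_zero y (T x) (hV x)
  rw [inner_sub_left, sub_eq_zero] at this
  rw [h, this]

theorem inner_eq_zero_of_mem_kernel {T : E →ₗ.[𝕜] F} (hT : Dense (T.domain : Set E))
    {x : E} (hx : x ∈ T.kernel) {y : F} {v : E} (h : (y, v) ∈ T.adjoint.graph) :
    inner 𝕜 x v = 0 := by
  obtain ⟨hx, hTx⟩ := mem_kernel_iff.1 hx
  rw [inner_eq_zero_symm, (mem_graph_adjoint_iff hT).1 h ⟨x, hx⟩, hTx, inner_zero_right]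

theorem IsClosed.orthogonal_range_adjoint_le_kernel [CompleteSpace F] {T : E →ₗ.[𝕜] F}
    (hT : Dense (T.domain : Set E)) (hTc : T.IsClosed) :
    (T.adjoint.graph.map (LinearMap.snd 𝕜 F E))ᗮ ≤ T.kernel := by
  intro w hw
  let Γ : Submodule 𝕜 (WithLp 2 (E × F)) :=
    T.graph.comap (WithLp.linearEquiv 2 𝕜 (E × F)).toLinearMap
  have hΓ : _root_.IsClosed (Γ : Set (WithLp 2 (E × F))) :=
    hTc.preimage (WithLp.prod_continuous_ofLp 2 E F)
  have : CompleteSpace Γ := hΓ.completeSpace_coe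
  let p := Γ.starProjection (WithLp.toLp 2 (w, 0))
  have hp : (p.fst, p.snd) ∈ T.graph := Γ.starProjection_apply_mem _
  have horth (x : T.domain) :
      inner 𝕜 (w - p.fst) (x : E) = inner 𝕜 p.snd (T x) := by
    have := Γ.starProjection_inner_eq_zero (WithLp.toLp 2 (w, 0)) (WithLp.toLp 2 ((x : E), T x))
      (T.mem_graph x)
    simpa [WithLp.prod_inner_apply, add_neg_eq_zero, p] using this
  have hres : (p.snd, w - p.fst) ∈ T.adjoint.graph := (mem_graph_adjoint_iff hT).2 horth
  have hw0 : inner 𝕜 (w - p.fst) w = 0 :=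
    hw _ ⟨_, hres, rfl⟩
  obtain ⟨x, hx, hTx⟩ := T.mem_graph_iff.1 hp
  have hsum : inner 𝕜 (w - p.fst) (w - p.fst) + inner 𝕜 p.snd p.snd = 0 := by
    have h := horth x
    rw [hx, hTx] at h
    rw [inner_sub_right, hw0, ← h]
    ring
  have hnorm : ‖w - p.fst‖ ^ 2 + ‖p.snd‖ ^ 2 = 0 := by
    simp only [inner_self_eq_norm_sq_to_K] at hsum
    exact_mod_cast hsum
  have h1 : w - p.fst = 0 := by
    rw [← norm_eq_zero]; nlinarith [sq_nonneg ‖w - p.fst‖, sq_nonneg ‖p.snd‖]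
  have h2 : p.snd = 0 := by
    rw [← norm_eq_zero]; nlinarith [sq_nonneg ‖w - p.fst‖, sq_nonneg ‖p.snd‖]
  rw [mem_kernel_iff_mem_graph, sub_eq_zero.1 h1, ← h2]
  exact hp

/-- The range of the adjoint is dense in the orthogonal complement of the kernel. -/
theorem IsClosed.orthogonal_kernel_le_closure_range_adjoint [CompleteSpace F] {T : E →ₗ.[𝕜] F}
    (hT : Dense (T.domain : Set E)) (hTc : T.IsClosed) :
    T.kernelᗮ ≤ (T.adjoint.graph.map (LinearMap.snd 𝕜 F E)).topologicalClosure := by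
  rw [← Submodule.orthogonal_orthogonal_eq_closure]
  exact Submodule.orthogonal_le (hTc.orthogonal_range_adjoint_le_kernel hT)

end LinearPMap

namespace ContinuousLinearMap

variable {𝕜 H K : Type*} [RCLike 𝕜] [NormedAddCommGroup H] [InnerProductSpace 𝕜 H]
  [CompleteSpace H] [NormedAddCommGroup K] [InnerProductSpace 𝕜 K] [CompleteSpace K]

/-- A bounded operator between Hilbert spaces is surjective iff its adjoint is bounded below. -/
theorem surjective_iff_adjoint_bounded_below (A : H →L[𝕜] K) :
    Function.Surjective A ↔ ∃ C : ℝ, 0 < C ∧ ∀ u, C * ‖u‖ ^ 2 ≤ ‖adjoint A u‖ ^ 2 := by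
  constructor
  · intro hA
    obtain ⟨c, hc, h⟩ := A.exists_preimage_norm_le hA
    refine ⟨(c ^ 2)⁻¹, by positivity, fun u => ?_⟩
    obtain ⟨x, hx, hxu⟩ := h u
    have hmul : ‖u‖ * ‖u‖ ≤ ‖u‖ * (c * ‖adjoint A u‖) := calc
      ‖u‖ * ‖u‖ = ‖inner 𝕜 (adjoint A u) x‖ := by
        simp [adjoint_inner_left, hx, inner_self_eq_norm_sq_to_K, sq]
      _ ≤ ‖adjoint A u‖ * ‖x‖ := norm_inner_le_norm _ _
      _ ≤ ‖adjoint A u‖ * (c * ‖u‖) := by gcongr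
      _ = ‖u‖ * (c * ‖adjoint A u‖) := by ring
    have hle : ‖u‖ ≤ c * ‖adjoint A u‖ := by
      rcases (norm_nonneg u).eq_or_lt with h0 | h0
      · rw [← h0]; positivity
      · exact le_of_mul_le_mul_left hmul h0
    rw [inv_mul_le_iff₀ (by positivity), ← mul_pow]
    gcongr
  · rintro ⟨C, hC, h⟩
    have hunit : IsUnit (A ∘L adjoint A) := by
      refine isUnit_of_forall_le_norm_inner_map _ (c := ⟨C, hC.le⟩) hC fun u => ?_
      have hself : ‖inner 𝕜 ((A ∘L adjoint A) u) u‖ = ‖adjoint A u‖ ^ 2 := by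
        rw [comp_apply, ← adjoint_inner_right, inner_self_eq_norm_sq_to_K]
        simp
      rw [hself, mul_comm]
      exact h u
    exact Function.Surjective.of_comp (g := adjoint A) (isUnit_iff_bijective.1 hunit).surjective

end ContinuousLinearMap


/-- **Functional-analysis lemma underlying Skoda's L² division method.**
Let `E₀, F₀, F₁, F₂` be complex Hilbert spaces, `P : F₀ → E₀` a bounded operator,
`T : F₀ → F₁` and `S : F₁ → F₂` closed densely defined operators with `S ∘ T = 0`.
Let `G ⊆ E₀` be a closed subspace with `P (Ker T) ⊆ G`.  Then `P (Ker T) = G` if and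
only if there is a constant `C > 0` such that
`‖P* u + T* β‖² + ‖S β‖² ≥ C ‖u‖²` for all `u ∈ G` and all `β ∈ Dom T* ∩ Dom S`. -/
theorem skoda_functional_analysis_lemma
    {E₀ F₀ F₁ F₂ : Type*}
    [NormedAddCommGroup E₀] [InnerProductSpace ℂ E₀] [CompleteSpace E₀]
    [NormedAddCommGroup F₀] [InnerProductSpace ℂ F₀] [CompleteSpace F₀]
    [NormedAddCommGroup F₁] [InnerProductSpace ℂ F₁] [CompleteSpace F₁]
    [NormedAddCommGroup F₂] [InnerProductSpace ℂ F₂] [CompleteSpace F₂]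
    (P : F₀ →L[ℂ] E₀)
    (T : F₀ →ₗ.[ℂ] F₁) (S : F₁ →ₗ.[ℂ] F₂)
    (hTdense : Dense (T.domain : Set F₀)) (hSdense : Dense (S.domain : Set F₁))
    (hTclosed : T.IsClosed) (hSclosed : S.IsClosed)
    (hmem : ∀ x : T.domain, T x ∈ S.domain)
    (hST : ∀ x : T.domain, S ⟨T x, hmem x⟩ = 0)
    (G : Submodule ℂ E₀) (hGclosed : IsClosed (G : Set E₀))
    (hPG : P '' {x : F₀ | ∃ hx : x ∈ T.domain, T ⟨x, hx⟩ = 0} ⊆ (G : Set E₀)) :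
    P '' {x : F₀ | ∃ hx : x ∈ T.domain, T ⟨x, hx⟩ = 0} = (G : Set E₀) ↔
      ∃ C : ℝ, 0 < C ∧
        ∀ u ∈ G, ∀ β : F₁, ∀ hβT : β ∈ T.adjoint.domain, ∀ hβS : β ∈ S.domain,
          ‖(ContinuousLinearMap.adjoint P) u + T.adjoint ⟨β, hβT⟩‖ ^ 2
            + ‖S ⟨β, hβS⟩‖ ^ 2 ≥ C * ‖u‖ ^ 2 := by
  let N := T.kernel
  have : CompleteSpace N := hTclosed.isClosed_kernel.completeSpace_coe
  have : CompleteSpace S.kernel := hSclosed.isClosed_kernel.completeSpace_coe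
  have : CompleteSpace G := hGclosed.completeSpace_coe
  have hN : {x : F₀ | ∃ hx : x ∈ T.domain, T ⟨x, hx⟩ = 0} = N :=
    Set.ext fun x => LinearPMap.mem_kernel_iff.symm
  rw [hN] at hPG ⊢
  let A : N →L[ℂ] G := (P ∘L N.subtypeL).codRestrict G fun x => hPG ⟨x, x.2, rfl⟩
  have hsurj : P '' (N : Set F₀) = G ↔ Function.Surjective A := by
    constructor
    · rintro h ⟨u, hu⟩
      obtain ⟨x, hx, rfl⟩ := h.ge hu
      exact ⟨⟨x, hx⟩, rfl⟩
    · refine fun h => hPG.antisymm fun u hu => ?_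
      obtain ⟨x, hx⟩ := h ⟨u, hu⟩
      exact ⟨x, x.2, congrArg Subtype.val hx⟩
  have hadj (u : G) : (ContinuousLinearMap.adjoint A u : F₀) =
      N.starProjection (ContinuousLinearMap.adjoint P u) := by
    refine (Submodule.eq_starProjection_of_mem_of_inner_eq_zero (Subtype.coe_prop _) ?_).symm
    intro x hx
    have h : inner ℂ (ContinuousLinearMap.adjoint A u) ⟨x, hx⟩ = inner ℂ (u : E₀) (P x) :=
      A.adjoint_inner_left _ _
    rw [inner_sub_left, P.adjoint_inner_left, ← h, Submodule.coe_inner, sub_self]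
  rw [hsurj, A.surjective_iff_adjoint_bounded_below]
  refine exists_congr fun C => and_congr_right fun _ => ⟨fun h u hu β hβT hβS => ?_, fun h u => ?_⟩
  · have hzero : N.starProjection (T.adjoint ⟨β, hβT⟩) = 0 :=
      (Submodule.starProjection_apply_eq_zero_iff N).2 fun x hx =>
        LinearPMap.inner_eq_zero_of_mem_kernel hTdense hx (T.adjoint.mem_graph ⟨β, hβT⟩)
    calc C * ‖u‖ ^ 2 ≤ ‖(ContinuousLinearMap.adjoint A ⟨u, hu⟩ : F₀)‖ ^ 2 := h ⟨u, hu⟩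
      _ = ‖N.starProjection (ContinuousLinearMap.adjoint P u + T.adjoint ⟨β, hβT⟩)‖ ^ 2 := by
        rw [hadj, map_add, hzero, add_zero]
      _ ≤ ‖ContinuousLinearMap.adjoint P u + T.adjoint ⟨β, hβT⟩‖ ^ 2 := by
        gcongr
        exact N.norm_starProjection_apply_le _
      _ ≤ _ := le_add_of_nonneg_right (sq_nonneg _)
  · set w := ContinuousLinearMap.adjoint P (u : E₀)
    have hclosed : IsClosed {v : F₀ | C * ‖(u : E₀)‖ ^ 2 ≤ ‖w + v‖ ^ 2} :=
      isClosed_le (by fun_prop) (by fun_prop)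
    have hrange : ((T.adjoint.graph.map (LinearMap.snd ℂ F₁ F₀) : Submodule ℂ F₀) : Set F₀) ⊆
        {v : F₀ | C * ‖(u : E₀)‖ ^ 2 ≤ ‖w + v‖ ^ 2} := by
      rintro _ ⟨⟨β, v⟩, hβ, rfl⟩
      have hproj := LinearPMap.starProjection_mem_graph_adjoint hTdense (V := S.kernel)
        (fun x => LinearPMap.mem_kernel_iff.2 ⟨hmem x, hST x⟩) hβ
      obtain ⟨⟨γ, hγT⟩, hγ, hγv⟩ := T.adjoint.mem_graph_iff.1 hproj
      have hγS : γ ∈ S.kernel := by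
        rw [show γ = S.kernel.starProjection β from hγ]
        exact S.kernel.starProjection_apply_mem β
      obtain ⟨hγS, hSγ⟩ := LinearPMap.mem_kernel_iff.1 hγS
      simpa [hSγ, hγv] using h u u.2 γ hγT hγS
    have hmemc : N.starProjection w - w ∈
        (T.adjoint.graph.map (LinearMap.snd ℂ F₁ F₀)).topologicalClosure :=
      hTclosed.orthogonal_kernel_le_closure_range_adjoint hTdense <| by
        rw [← neg_sub]
        exact neg_mem (N.sub_starProjection_mem_orthogonal w)
    have hfinal : C * ‖(u : E₀)‖ ^ 2 ≤ ‖w + (N.starProjection w - w)‖ ^ 2 :=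
      closure_minimal hrange hclosed hmemc
    rwa [add_sub_cancel, ← hadj] at hfinal
end

section
/- Let Ω be a topological space, let φ : Ω → ℝ be a function, let k ≥ 1 be an integer, and let f, a₁, …, a_k : Ω → ℂ be functions satisfying the monic equation f(x)^k + a₁(x) f(x)^{k−1} + ⋯ + a_{k−1}(x) f(x) + a_k(x) = 0 for every x ∈ Ω. If for each 1 ≤ i ≤ k the function |a_i|² e^{−iφ} is locally bounded above on Ω, then |f|² e^{−φ} is locally bounded above on Ω. -/
/-- A real-valued function is locally bounded above if every point has a
neighborhood on which the function is bounded above. -/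
def LocallyBddAbove {Ω : Type*} [TopologicalSpace Ω] (h : Ω → ℝ) : Prop :=
  ∀ x : Ω, ∃ U ∈ nhds x, ∃ M : ℝ, ∀ y ∈ U, h y ≤ M

/-- **Lagrange's bound.** A root of a monic polynomial has norm at most `1` or at most the sum of
the norms of the lower coefficients. -/
lemma norm_le_max_one_sum_norm_of_monic_root {k : ℕ} (hk : 1 ≤ k) (z : ℂ) (c : Fin k → ℂ)
    (h : z ^ k + ∑ i : Fin k, c i * z ^ (k - 1 - (i : ℕ)) = 0) :
    ‖z‖ ≤ max 1 (∑ i, ‖c i‖) := by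
  rcases le_or_gt ‖z‖ 1 with hz | hz
  · exact le_max_of_le_left hz
  refine le_max_of_le_right ?_
  have hpos : 0 < ‖z‖ ^ (k - 1) := by positivity
  refine le_of_mul_le_mul_right ?_ hpos
  calc ‖z‖ * ‖z‖ ^ (k - 1) = ‖z ^ k‖ := by
        rw [norm_pow, mul_pow_sub_one (by omega)]
    _ = ‖∑ i : Fin k, c i * z ^ (k - 1 - (i : ℕ))‖ := by
        rw [eq_neg_of_add_eq_zero_left h, norm_neg]
    _ ≤ ∑ i : Fin k, ‖c i‖ * ‖z‖ ^ (k - 1) := by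
        refine norm_sum_le_of_le _ fun i _ => ?_
        rw [norm_mul, norm_pow]
        gcongr ‖c i‖ * ?_
        exact pow_le_pow_right₀ hz.le (Nat.sub_le _ _)
    _ = (∑ i, ‖c i‖) * ‖z‖ ^ (k - 1) := by rw [Finset.sum_mul]

/-- Rescaling a root of a monic polynomial by `r` rescales the coefficient of codegree `j`
by `r ^ j`. -/
lemma monic_root_mul {k : ℕ} (z r : ℂ) (c : Fin k → ℂ)
    (h : z ^ k + ∑ i : Fin k, c i * z ^ (k - 1 - (i : ℕ)) = 0) :
    (z * r) ^ k + ∑ i : Fin k, (c i * r ^ ((i : ℕ) + 1)) * (z * r) ^ (k - 1 - (i : ℕ)) = 0 := by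
  rw [← mul_zero (r ^ k), ← h, mul_add, Finset.mul_sum, mul_pow, mul_comm (z ^ k)]
  congr 1
  refine Finset.sum_congr rfl fun i _ => ?_
  have hi : r ^ k = r ^ ((i : ℕ) + 1) * r ^ (k - 1 - (i : ℕ)) := by
    rw [← pow_add]
    congr 1
    omega
  rw [hi, mul_pow]
  ring

/-- **Sublevel ideal sheaves are integrally closed.**
If `f^k + a₁ f^{k-1} + ⋯ + a_k = 0` on `Ω` and, for each `1 ≤ i ≤ k`, the function
`|a_i|² e^{-iφ}` is locally bounded above, then `|f|² e^{-φ}` is locally bounded above. -/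
theorem sublevel_integrally_closed
    {Ω : Type*} [TopologicalSpace Ω] (φ : Ω → ℝ)
    (k : ℕ) (hk : 1 ≤ k)
    (f : Ω → ℂ) (a : Fin k → Ω → ℂ)
    (heq : ∀ x : Ω, f x ^ k + ∑ i : Fin k, a i x * f x ^ (k - 1 - (i : ℕ)) = 0)
    (ha : ∀ i : Fin k,
      LocallyBddAbove fun x => ‖a i x‖ ^ 2 * Real.exp (-(((i : ℕ) + 1 : ℝ)) * φ x)) :
    LocallyBddAbove fun x => ‖f x‖ ^ 2 * Real.exp (-φ x) := by
  intro x
  choose U hU M hM using fun i => ha i x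
  refine ⟨⋂ i, U i, Filter.iInter_mem.2 hU, (max 1 (∑ i, (1 + M i))) ^ 2, fun y hy => ?_⟩
  have hsq : ∀ (w : ℂ) (n : ℕ), ‖w * (Real.exp (-φ y / 2) : ℂ) ^ n‖ ^ 2
      = ‖w‖ ^ 2 * Real.exp (-(n : ℝ) * φ y) := by
    intro w n
    rw [norm_mul, norm_pow, Complex.norm_real, Real.norm_of_nonneg (Real.exp_pos _).le, mul_pow,
      ← Real.exp_nat_mul, ← Real.exp_nat_mul]
    congr 2
    push_cast
    ring
  have hroot := norm_le_max_one_sum_norm_of_monic_root hk _ _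
    (monic_root_mul (f y) (Real.exp (-φ y / 2) : ℂ) (fun i => a i y) (heq y))
  have hf := hsq (f y) 1
  rw [pow_one, Nat.cast_one, neg_one_mul] at hf
  change ‖f y‖ ^ 2 * Real.exp (-φ y) ≤ _
  rw [← hf]
  gcongr
  refine hroot.trans (max_le_max le_rfl (Finset.sum_le_sum fun i _ => ?_))
  have hi := hM i y (Set.mem_iInter.1 hy i)
  have hai := hsq (a i y) ((i : ℕ) + 1)
  push_cast at hi hai ⊢
  rw [← hai] at hi
  nlinarith [sq_nonneg (‖a i y * Complex.exp (-φ y / 2) ^ ((i : ℕ) + 1)‖ - 1)]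
end

section
/- Let p ≥ 1 and m ≥ 1 be integers with m ≤ p, let g = (g₁, …, g_p) ∈ ℂ^p, and let u = (u_I) be a family of complex numbers indexed by the (m−1)-element subsets I of {1,…,p}. Suppose Pu = 0, i.e. Σ_{t∉K} (−1)^{pos(t, K∪{t})} g_t u_{K∪{t}} = 0 for every (m−2)-element subset K of {1,…,p} (vacuous when m = 1). Then Σ_{J : |J| = m} | Σ_{t∈J} (−1)^{pos(t,J)} \overline{g_t} u_{J∖{t}} |² = (Σ_{s=1}^p |g_s|²) · Σ_{I : |I| = m−1} |u_I|², where J ranges over the m-element subsets and I over the (m−1)-element subsets of {1,…,p}. -/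
open Finset

namespace Koszul

variable {ι : Type*} [LinearOrder ι]

/-- The Koszul sign `(-1) ^ pos(t, J)`. -/
def sign (J : Finset ι) (t : ι) : ℂ := (-1) ^ (J.filter (· < t)).card

lemma sign_mul_self (J : Finset ι) (t : ι) : sign J t * sign J t = 1 := by
  rw [sign, ← mul_pow]; simp

lemma star_sign (J : Finset ι) (t : ι) : starRingEnd ℂ (sign J t) = sign J t := by
  simp [sign]

lemma sign_insert {I : Finset ι} {s : ι} (hs : s ∉ I) (t : ι) :
    sign (insert s I) t = (if s < t then -1 else 1) * sign I t := by
  unfold sign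
  rw [filter_insert]
  split_ifs with h
  · rw [card_insert_of_notMem (by simp [hs]), pow_succ]; ring
  · simp

lemma sign_insert_self {I : Finset ι} {s : ι} (hs : s ∉ I) :
    sign (insert s I) s = sign I s := by
  simp [sign_insert hs]

lemma sign_erase_self {I : Finset ι} {t : ι} (ht : t ∈ I) :
    sign (I.erase t) t = sign I t := by
  rw [← sign_insert_self (notMem_erase t I), insert_erase ht]

lemma sign_mul_sign_insert {I : Finset ι} {s t : ι} (hs : s ∉ I) (ht : t ∈ I) :
    sign I s * sign (insert s I) t = -(sign I t * sign (I.erase t) s) := by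
  have h := sign_insert (notMem_erase t I) s
  rw [insert_erase ht] at h
  rw [sign_insert hs, h]
  rcases lt_trichotomy s t with hst | rfl | hst
  · simp [hst, hst.not_gt]; ring
  · exact absurd ht hs
  · simp [hst, hst.not_gt]; ring

/-- The adjoint Koszul map. -/
def wedge (g : ι → ℂ) (v : Finset ι → ℂ) (J : Finset ι) : ℂ :=
  ∑ t ∈ J, sign J t * starRingEnd ℂ (g t) * v (J.erase t)

variable [Fintype ι]

/-- The Koszul contraction. -/
def contract (g : ι → ℂ) (v : Finset ι → ℂ) (K : Finset ι) : ℂ :=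
  ∑ t ∈ Kᶜ, sign K t * g t * v (insert t K)

/-- Cartan's formula for the Koszul contraction and its adjoint. -/
lemma contract_wedge_add_wedge_contract (g : ι → ℂ) (v : Finset ι → ℂ) (I : Finset ι) :
    contract g (wedge g v) I + wedge g (contract g v) I
      = (∑ s, starRingEnd ℂ (g s) * g s) * v I := by
  have h₁ : contract g (wedge g v) I = (∑ s ∈ Iᶜ, starRingEnd ℂ (g s) * g s) * v I
      + ∑ s ∈ Iᶜ, ∑ t ∈ I, sign I s * sign (insert s I) t * (g s * starRingEnd ℂ (g t))
          * v ((insert s I).erase t) := by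
    rw [contract, sum_mul, ← sum_add_distrib]
    refine sum_congr rfl fun s hs => ?_
    have hs : s ∉ I := by simpa using hs
    rw [wedge, sum_insert hs, mul_add, mul_sum, erase_insert hs, sign_insert_self hs]
    congr 1
    · linear_combination (starRingEnd ℂ (g s) * g s * v I) * sign_mul_self I s
    · exact sum_congr rfl fun t _ => by ring
  have h₂ : wedge g (contract g v) I = (∑ t ∈ I, starRingEnd ℂ (g t) * g t) * v I
      + ∑ t ∈ I, ∑ s ∈ Iᶜ, sign I t * sign (I.erase t) s * (g s * starRingEnd ℂ (g t))
          * v (insert s (I.erase t)) := by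
    rw [wedge, sum_mul, ← sum_add_distrib]
    refine sum_congr rfl fun t ht => ?_
    rw [contract, compl_erase, sum_insert (by simpa using ht), mul_add, mul_sum,
      insert_erase ht, sign_erase_self ht]
    congr 1
    · linear_combination (starRingEnd ℂ (g t) * g t * v I) * sign_mul_self I t
    · exact sum_congr rfl fun s _ => by ring
  have h₃ : ∑ s ∈ Iᶜ, ∑ t ∈ I, sign I s * sign (insert s I) t * (g s * starRingEnd ℂ (g t))
          * v ((insert s I).erase t)
      = -∑ t ∈ I, ∑ s ∈ Iᶜ, sign I t * sign (I.erase t) s * (g s * starRingEnd ℂ (g t))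
          * v (insert s (I.erase t)) := by
    rw [sum_comm, ← sum_neg_distrib]
    refine sum_congr rfl fun t ht => ?_
    rw [← sum_neg_distrib]
    refine sum_congr rfl fun s hs => ?_
    have hs : s ∉ I := by simpa using hs
    rw [sign_mul_sign_insert hs ht, erase_insert_of_ne (by rintro rfl; exact hs ht)]
    ring
  rw [h₁, h₂, h₃, ← sum_add_sum_compl I]
  ring

/-- The maps `wedge g` and `contract g` are adjoint to each other. -/
lemma sum_star_mul_wedge (g : ι → ℂ) (a b : Finset ι → ℂ) (n : ℕ) :
    ∑ J ∈ powersetCard (n + 1) univ, starRingEnd ℂ (a J) * wedge g b J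
      = ∑ I ∈ powersetCard n univ, starRingEnd ℂ (contract g a I) * b I := by
  simp only [wedge, contract, mul_sum, map_sum, sum_mul]
  rw [sum_sigma', sum_sigma']
  refine sum_bij' (fun x _ => ⟨x.1.erase x.2, x.2⟩) (fun x _ => ⟨insert x.2 x.1, x.2⟩)
    ?_ ?_ ?_ ?_ ?_
  · rintro ⟨J, t⟩ h
    simp only [mem_sigma, mem_powersetCard_univ] at h
    simp [card_erase_of_mem h.2, h.1]
  · rintro ⟨I, t⟩ h
    simp only [mem_sigma, mem_powersetCard_univ, mem_compl] at h
    simp [card_insert_of_notMem h.2, h.1]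
  · rintro ⟨J, t⟩ h
    simp only [mem_sigma] at h
    simp [insert_erase h.2]
  · rintro ⟨I, t⟩ h
    simp only [mem_sigma, mem_compl] at h
    simp [erase_insert h.2]
  · rintro ⟨J, t⟩ h
    simp only [mem_sigma] at h
    simp only [map_mul, star_sign, sign_erase_self h.2, insert_erase h.2]
    ring

end Koszul

/-- **Pointwise isometry of the adjoint Koszul map on the kernel:
`‖P* u‖² = |g|² ‖u‖²` whenever `Pu = 0`.**
Here `u` is a family of degree `m - 1`, `Pu = 0` means
`Σ_{t ∉ K} (-1)^{pos(t, K∪{t})} g_t u_{K∪{t}} = 0` for every `(m-2)`-element subset `K`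
(vacuous when `m = 1`), and `pos(t, J) = #{j ∈ J : j < t}`. -/
theorem koszul_adjoint_isometry_on_kernel
    (p m : ℕ) (hm : 1 ≤ m) (hmp : m ≤ p)
    (g : Fin p → ℂ) (u : Finset (Fin p) → ℂ)
    (hker : ∀ K : Finset (Fin p), K.card + 2 = m →
      ∑ t ∈ Kᶜ, (-1 : ℂ) ^ (K.filter (· < t)).card * g t * u (insert t K) = 0) :
    ∑ J ∈ Finset.powersetCard m (Finset.univ : Finset (Fin p)),
        ‖∑ t ∈ J, (-1 : ℂ) ^ (J.filter (· < t)).card * (starRingEnd ℂ) (g t) * u (J.erase t)‖ ^ 2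
      = (∑ s, ‖g s‖ ^ 2) *
        ∑ I ∈ Finset.powersetCard (m - 1) (Finset.univ : Finset (Fin p)), ‖u I‖ ^ 2 := by
  obtain ⟨n, rfl⟩ : ∃ n, m = n + 1 := ⟨m - 1, by omega⟩
  have hwedge : ∀ I ∈ powersetCard n (univ : Finset (Fin p)),
      Koszul.contract g (Koszul.wedge g u) I = (∑ s, starRingEnd ℂ (g s) * g s) * u I := by
    intro I hI
    rw [← Koszul.contract_wedge_add_wedge_contract, left_eq_add]
    refine sum_eq_zero fun t ht => ?_
    have hcard := card_erase_add_one ht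
    rw [mem_powersetCard_univ] at hI
    exact mul_eq_zero_of_right _ (hker (I.erase t) (by omega))
  have h := Koszul.sum_star_mul_wedge g (Koszul.wedge g u) u n
  have h' : ∑ I ∈ powersetCard n univ,
        starRingEnd ℂ (Koszul.contract g (Koszul.wedge g u) I) * u I
      = (∑ s, (‖g s‖ : ℂ) ^ 2) * ∑ I ∈ powersetCard n univ, (‖u I‖ : ℂ) ^ 2 := by
    rw [mul_sum]
    refine sum_congr rfl fun I hI => ?_
    simp only [hwedge I hI, Complex.conj_mul', map_mul, map_sum, map_pow, Complex.conj_ofReal,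
      mul_assoc]
  simp only [h', Complex.conj_mul'] at h
  norm_cast at h
end

section
/- Let p ≥ 1 and 1 ≤ m ≤ p be integers, let g = (g₁, …, g_p) ∈ ℂ^p, and for every m-element subset J ⊆ {1,…,p} and every ordered pair (s,t) with 1 ≤ s,t ≤ p, let c_{s,t,J} ∈ ℂ satisfy the antisymmetry c_{s,t,J} = −c_{t,s,J} (in particular c_{t,t,J} = 0). Then Σ_{I : |I| = m−1} | Σ_{s=1}^p \overline{g_s} Σ_{t∉I} c_{s,t,I∪{t}} |² ≤ m(p−m+1) · (Σ_{s=1}^p |g_s|²) · Σ_{J : |J| = m} Σ_{1 ≤ q < r ≤ p} |c_{q,r,J}|², where I ranges over the (m−1)-element subsets and J over the m-element subsets of {1,…,p}. -/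
open Finset

/-- Summing over a set and a point outside it is the same as summing over a set of one more
element and a point inside it. -/
theorem sum_powersetCard_sum_compl_insert {α M : Type*} [Fintype α] [DecidableEq α]
    [AddCommMonoid M] (k : ℕ) (F : α → Finset α → M) :
    ∑ I ∈ powersetCard k (univ : Finset α), ∑ t ∈ Iᶜ, F t (insert t I) =
      ∑ J ∈ powersetCard (k + 1) (univ : Finset α), ∑ t ∈ J, F t J := by
  rw [sum_sigma', sum_sigma']
  refine sum_bij' (fun x _ => ⟨insert x.2 x.1, x.2⟩) (fun x _ => ⟨x.1.erase x.2, x.2⟩) ?_ ?_ ?_ ?_ ?_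
  · rintro ⟨I, t⟩ h
    simp only [mem_sigma, mem_powersetCard_univ, mem_compl] at h ⊢
    exact ⟨by rw [card_insert_of_notMem h.2, h.1], mem_insert_self _ _⟩
  · rintro ⟨J, t⟩ h
    simp only [mem_sigma, mem_powersetCard_univ, mem_compl] at h ⊢
    exact ⟨by rw [card_erase_of_mem h.2, h.1, Nat.add_sub_cancel], notMem_erase _ _⟩
  · rintro ⟨I, t⟩ h
    simp only [mem_sigma, mem_compl] at h
    simp [erase_insert h.2]
  · rintro ⟨J, t⟩ h
    simp only [mem_sigma] at h
    simp [insert_erase h.2]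
  · rintro ⟨I, t⟩ _
    rfl

/-- A single column sum of a nonnegative symmetric array with zero diagonal is at most the sum
over its strict upper triangle. -/
theorem sum_column_le_sum_upper {ι : Type*} [Fintype ι] [LinearOrder ι] (f : ι → ι → ℝ)
    (hf : ∀ s t, 0 ≤ f s t) (hsymm : ∀ s t, f s t = f t s) (hdiag : ∀ t, f t t = 0) (t : ι) :
    ∑ s, f s t ≤ ∑ q, ∑ r ∈ univ.filter (fun r => q < r), f q r := by
  have hsplit : ∑ s, f s t = ∑ q, ((if q < t then f q t else 0) +
      if q = t then ∑ r ∈ univ.filter (fun r => t < r), f t r else 0) := by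
    rw [sum_add_distrib, sum_ite_eq' univ t, if_pos (mem_univ t), sum_filter, ← sum_add_distrib]
    refine sum_congr rfl fun s _ => ?_
    rcases lt_trichotomy s t with h | h | h
    · simp [h, h.not_gt]
    · simp [h, hdiag]
    · simp [h, h.not_gt, hsymm s t]
  rw [hsplit]
  refine sum_le_sum fun q _ => ?_
  by_cases hq : q = t
  · simp [hq]
  · by_cases hlt : q < t
    · simpa [hq, hlt] using
        single_le_sum (f := f q) (fun r _ => hf q r) (mem_filter.2 ⟨mem_univ t, hlt⟩)
    · simpa [hq, hlt] using sum_nonneg fun r _ => hf q r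

/-- The Cauchy–Schwarz inequality for finite sums of complex numbers, with norms. -/
theorem norm_sum_mul_sq_le {ι : Type*} (S : Finset ι) (a b : ι → ℂ) :
    ‖∑ i ∈ S, a i * b i‖ ^ 2 ≤ (∑ i ∈ S, ‖a i‖ ^ 2) * ∑ i ∈ S, ‖b i‖ ^ 2 := by
  refine le_trans ?_ (sum_mul_sq_le_sq_mul_sq S (fun i => ‖a i‖) fun i => ‖b i‖)
  gcongr
  simpa only [norm_mul] using norm_sum_le S fun i => a i * b i

/-- **Composite Cauchy–Schwarz and counting inequality** (steps (a1)–(a4) in the proof of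
the exactness of the Skoda complex): for an antisymmetric family `c_{s,t,J}`,
`Σ_I |Σ_s conj(g_s) Σ_{t∉I} c_{s,t,I∪{t}}|²
  ≤ m(p-m+1) · |g|² · Σ_J Σ_{q<r} |c_{q,r,J}|²`. -/
theorem skoda_cauchy_schwarz_counting
    (p m : ℕ) (hm : 1 ≤ m) (hmp : m ≤ p)
    (g : Fin p → ℂ)
    (c : Fin p → Fin p → Finset (Fin p) → ℂ)
    (hanti : ∀ s t : Fin p, ∀ J : Finset (Fin p), J.card = m → c s t J = -c t s J) :
    ∑ I ∈ Finset.powersetCard (m - 1) (Finset.univ : Finset (Fin p)),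
        ‖∑ s : Fin p, (starRingEnd ℂ) (g s) * ∑ t ∈ Iᶜ, c s t (insert t I)‖ ^ 2
      ≤ (m : ℝ) * ((p : ℝ) - m + 1) * (∑ s, ‖g s‖ ^ 2) *
        ∑ J ∈ Finset.powersetCard m (Finset.univ : Finset (Fin p)),
          ∑ q : Fin p, ∑ r ∈ Finset.univ.filter (fun r => q < r), ‖c q r J‖ ^ 2 := by
  obtain ⟨k, rfl⟩ : ∃ k, m = k + 1 := ⟨m - 1, by omega⟩
  rw [Nat.add_sub_cancel]
  have hpk : (0 : ℝ) ≤ (p : ℝ) - k := sub_nonneg.2 (by exact_mod_cast (by omega : k ≤ p))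
  have hI : ∀ I ∈ powersetCard k (univ : Finset (Fin p)),
      ‖∑ s : Fin p, (starRingEnd ℂ) (g s) * ∑ t ∈ Iᶜ, c s t (insert t I)‖ ^ 2 ≤
        (∑ s, ‖g s‖ ^ 2) * (((p : ℝ) - k) * ∑ t ∈ Iᶜ, ∑ s, ‖c s t (insert t I)‖ ^ 2) := by
    intro I hI
    have hcard : ((Iᶜ.card : ℕ) : ℝ) = (p : ℝ) - k := by
      rw [card_compl, Fintype.card_fin, (mem_powersetCard.1 hI).2, Nat.cast_sub (by omega)]
    refine (norm_sum_mul_sq_le _ _ _).trans ?_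
    simp only [RCLike.norm_conj]
    gcongr
    rw [sum_comm, mul_sum]
    refine sum_le_sum fun s _ => ?_
    simpa [← hcard] using norm_sum_mul_sq_le Iᶜ (fun _ => 1) fun t => c s t (insert t I)
  have hJ : ∀ J ∈ powersetCard (k + 1) (univ : Finset (Fin p)),
      ∑ t ∈ J, ∑ s, ‖c s t J‖ ^ 2 ≤
        ((k + 1 : ℕ) : ℝ) * ∑ q : Fin p, ∑ r ∈ univ.filter (fun r => q < r), ‖c q r J‖ ^ 2 := by
    intro J hJ
    have hcard := (mem_powersetCard.1 hJ).2
    rw [← hcard, ← nsmul_eq_mul]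
    refine sum_le_card_nsmul _ _ _ fun t _ =>
      sum_column_le_sum_upper (fun s t => ‖c s t J‖ ^ 2) (fun _ _ => by positivity)
        (fun s t => by rw [hanti s t J hcard, norm_neg]) (fun t => ?_) t
    simp [self_eq_neg.1 (hanti t t J hcard)]
  calc
    _ ≤ _ := sum_le_sum hI
    _ = (∑ s, ‖g s‖ ^ 2) * (((p : ℝ) - k) *
          ∑ J ∈ powersetCard (k + 1) (univ : Finset (Fin p)), ∑ t ∈ J, ∑ s, ‖c s t J‖ ^ 2) := by
      rw [← mul_sum, ← mul_sum,
        sum_powersetCard_sum_compl_insert k fun t J => ∑ s, ‖c s t J‖ ^ 2]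
    _ ≤ (∑ s, ‖g s‖ ^ 2) * (((p : ℝ) - k) *
          ∑ J ∈ powersetCard (k + 1) (univ : Finset (Fin p)), ((k + 1 : ℕ) : ℝ) *
            ∑ q : Fin p, ∑ r ∈ univ.filter (fun r => q < r), ‖c q r J‖ ^ 2) := by
      gcongr with J hJ'
      exact hJ J hJ'
    _ = _ := by
      rw [← mul_sum]
      push_cast
      ring
end
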